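/- Let M be a popular feasible matching in a marriage instance with critical men, and let ρ be an M-alternating path both of whose terminal edges lie in M and whose endpoint in A is a non-critical man. Then the number of (+1,+1) edges of ρ is at most one more than the number of (−1,−1) edges of ρ. -/

import Mathlib

open Classical

universe u v

/-- A marriage instance with critical men: a finite bipartite graph with edge set `E ⊆ A × B`,
a set `C ⊆ A` of critical men, and strict preference orders of each vertex over its
neighbours (`prefA m w w'` : man `m` strictly prefers woman `w` to woman `w'`;
`prefB w m m'` : woman `w` strictly prefers man `m` to man `m'`). -/
structure CritInstance (A : Type u) (B : Type v) where
  E : Finset (A × B)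
  C : Finset A
  prefA : A → B → B → Prop
  prefB : B → A → A → Prop
  prefA_irrefl : ∀ m w, ¬ prefA m w w
  prefA_trans : ∀ m w₁ w₂ w₃, prefA m w₁ w₂ → prefA m w₂ w₃ → prefA m w₁ w₃
  prefA_total : ∀ m w₁ w₂, (m, w₁) ∈ E → (m, w₂) ∈ E → w₁ ≠ w₂ →
    prefA m w₁ w₂ ∨ prefA m w₂ w₁
  prefB_irrefl : ∀ w m, ¬ prefB w m m
  prefB_trans : ∀ w m₁ m₂ m₃, prefB w m₁ m₂ → prefB w m₂ m₃ → prefB w m₁ m₃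
  prefB_total : ∀ w m₁ m₂, (m₁, w) ∈ E → (m₂, w) ∈ E → m₁ ≠ m₂ →
    prefB w m₁ m₂ ∨ prefB w m₂ m₁

namespace CritInstance

variable {A : Type u} {B : Type v}

/-- `M` is a matching: a set of edges in which every vertex has at most one partner. -/
def IsMatching (I : CritInstance A B) (M : Finset (A × B)) : Prop :=
  M ⊆ I.E ∧ (∀ ⦃m w w'⦄, (m, w) ∈ M → (m, w') ∈ M → w = w') ∧
    (∀ ⦃m m' w⦄, (m, w) ∈ M → (m', w) ∈ M → m = m')

/-- Man `m` is matched in `M`. -/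
def ManMatched (M : Finset (A × B)) (m : A) : Prop := ∃ w, (m, w) ∈ M

/-- Woman `w` is matched in `M`. -/
def WomanMatched (M : Finset (A × B)) (w : B) : Prop := ∃ m, (m, w) ∈ M

/-- `M` is feasible: it is a matching and every critical man is matched. -/
def IsFeasible (I : CritInstance A B) (M : Finset (A × B)) : Prop :=
  IsMatching I M ∧ ∀ m ∈ I.C, ManMatched M m

/-- Man `m` prefers matching `M` to matching `N`: he is matched in `M` and either
unmatched in `N` or strictly prefers his `M`-partner to his `N`-partner. -/
def ManPrefers (I : CritInstance A B) (M N : Finset (A × B)) (m : A) : Prop :=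
  ∃ w, (m, w) ∈ M ∧ (¬ ManMatched N m ∨ ∃ w', (m, w') ∈ N ∧ I.prefA m w w')

/-- Woman `w` prefers matching `M` to matching `N`. -/
def WomanPrefers (I : CritInstance A B) (M N : Finset (A × B)) (w : B) : Prop :=
  ∃ m, (m, w) ∈ M ∧ (¬ WomanMatched N w ∨ ∃ m', (m', w) ∈ N ∧ I.prefB w m m')

/-- `phi I M N` is the number of vertices that prefer `M` to `N`. -/
noncomputable def phi [Fintype A] [Fintype B] (I : CritInstance A B)
    (M N : Finset (A × B)) : ℕ :=
  (Finset.univ.filter fun m : A => ManPrefers I M N m).card +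
    (Finset.univ.filter fun w : B => WomanPrefers I M N w).card

/-- `M` is a popular feasible matching. -/
def IsPFM [Fintype A] [Fintype B] (I : CritInstance A B) (M : Finset (A × B)) : Prop :=
  IsFeasible I M ∧ ∀ N, IsFeasible I N → phi I N M ≤ phi I M N

/-- `M` is a minimum size popular feasible matching. -/
def IsMinPFM [Fintype A] [Fintype B] (I : CritInstance A B) (M : Finset (A × B)) : Prop :=
  IsPFM I M ∧ ∀ N, IsPFM I N → M.card ≤ N.card

/-- `M` is a dominant feasible matching. -/
def IsDFM [Fintype A] [Fintype B] (I : CritInstance A B) (M : Finset (A × B)) : Prop :=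
  IsPFM I M ∧ ∀ N, IsFeasible I N → M.card < N.card → phi I N M < phi I M N

/-- `(m,w)` is a `(+1,+1)` edge with respect to `M`: an edge of `E ∖ M` such that `m` is
unmatched or prefers `w` to his partner, and `w` is unmatched or prefers `m` to her partner. -/
def PlusPlus (I : CritInstance A B) (M : Finset (A × B)) (m : A) (w : B) : Prop :=
  (m, w) ∈ I.E ∧ (m, w) ∉ M ∧
    (¬ ManMatched M m ∨ ∃ w', (m, w') ∈ M ∧ I.prefA m w w') ∧
    (¬ WomanMatched M w ∨ ∃ m', (m', w) ∈ M ∧ I.prefB w m m')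

/-- `(m,w)` is a `(−1,−1)` edge with respect to `M`: an edge of `E ∖ M` such that `m` is
matched and prefers his partner to `w`, and `w` is matched and prefers her partner to `m`. -/
def MinusMinus (I : CritInstance A B) (M : Finset (A × B)) (m : A) (w : B) : Prop :=
  (m, w) ∈ I.E ∧ (m, w) ∉ M ∧
    (∃ w', (m, w') ∈ M ∧ I.prefA m w' w) ∧
    (∃ m', (m', w) ∈ M ∧ I.prefB w m' m)

/-- `M` is a stable matching: a matching with no blocking pair. -/
def IsStable (I : CritInstance A B) (M : Finset (A × B)) : Prop :=
  IsMatching I M ∧ ∀ m w, ¬ PlusPlus I M m w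

/-- The min-size conditions for a level assignment `(lA, lB)` with respect to `M`:
(i) matched partners share a level, unmatched vertices have level 0, non-critical men
have level 0; (ii) every `(+1,+1)` edge goes from a man to a strictly higher level woman;
(iii) every edge from a man at level `i` to a woman at level `i − 1` is a `(−1,−1)` edge;
(iv) no edge goes from a man at level `i` to a woman at level `≤ i − 2`. -/
def MinSizeConds (I : CritInstance A B) (M : Finset (A × B))
    (lA : A → ℕ) (lB : B → ℕ) : Prop :=
  (∀ m w, (m, w) ∈ M → lA m = lB w) ∧
  (∀ m, ¬ ManMatched M m → lA m = 0) ∧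
  (∀ w, ¬ WomanMatched M w → lB w = 0) ∧
  (∀ m, m ∉ I.C → lA m = 0) ∧
  (∀ m w, PlusPlus I M m w → lA m < lB w) ∧
  (∀ m w, (m, w) ∈ I.E → lB w + 1 = lA m → MinusMinus I M m w) ∧
  (∀ m w, (m, w) ∈ I.E → ¬ (lB w + 2 ≤ lA m))

/-- The dominant conditions for a level assignment `(lA, lB)` with respect to `M`:
(i) matched partners share a level, unmatched women have level 0, unmatched men have
level 1, non-critical men have level at most 1; (ii)–(iv) as in the min-size conditions. -/
def DomConds (I : CritInstance A B) (M : Finset (A × B))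
    (lA : A → ℕ) (lB : B → ℕ) : Prop :=
  (∀ m w, (m, w) ∈ M → lA m = lB w) ∧
  (∀ m, ¬ ManMatched M m → lA m = 1) ∧
  (∀ w, ¬ WomanMatched M w → lB w = 0) ∧
  (∀ m, m ∉ I.C → lA m ≤ 1) ∧
  (∀ m w, PlusPlus I M m w → lA m < lB w) ∧
  (∀ m w, (m, w) ∈ I.E → lB w + 1 = lA m → MinusMinus I M m w) ∧
  (∀ m w, (m, w) ∈ I.E → ¬ (lB w + 2 ≤ lA m))

/-- Adjacency in the bipartite graph, on the vertex set `A ⊕ B`. -/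
def Adj (I : CritInstance A B) : A ⊕ B → A ⊕ B → Prop
  | Sum.inl m, Sum.inr w => (m, w) ∈ I.E
  | Sum.inr w, Sum.inl m => (m, w) ∈ I.E
  | _, _ => False

/-- The (directed) pair `(u, v)` of vertices spans an edge of the matching `M`. -/
def StepM (M : Finset (A × B)) : A ⊕ B → A ⊕ B → Prop
  | Sum.inl m, Sum.inr w => (m, w) ∈ M
  | Sum.inr w, Sum.inl m => (m, w) ∈ M
  | _, _ => False

/-- The pair `(u, v)` of vertices spans a `(+1,+1)` edge with respect to `M`. -/
def StepPP (I : CritInstance A B) (M : Finset (A × B)) : A ⊕ B → A ⊕ B → Prop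
  | Sum.inl m, Sum.inr w => PlusPlus I M m w
  | Sum.inr w, Sum.inl m => PlusPlus I M m w
  | _, _ => False

/-- The pair `(u, v)` of vertices spans a `(−1,−1)` edge with respect to `M`. -/
def StepMM (I : CritInstance A B) (M : Finset (A × B)) : A ⊕ B → A ⊕ B → Prop
  | Sum.inl m, Sum.inr w => MinusMinus I M m w
  | Sum.inr w, Sum.inl m => MinusMinus I M m w
  | _, _ => False

/-- A vertex of `A ⊕ B` is matched in `M`. -/
def VMatched (M : Finset (A × B)) : A ⊕ B → Prop
  | Sum.inl m => ManMatched M m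
  | Sum.inr w => WomanMatched M w

/-- An `M`-alternating path in the graph: a sequence of distinct vertices
`vert 0, …, vert len` (`len ≥ 1` edges), consecutive vertices adjacent, with
consecutive edges alternately inside and outside `M`. -/
structure AltPath (I : CritInstance A B) (M : Finset (A × B)) where
  len : ℕ
  len_pos : 0 < len
  vert : ℕ → A ⊕ B
  inj : ∀ i j, i ≤ len → j ≤ len → vert i = vert j → i = j
  adj : ∀ i, i < len → Adj I (vert i) (vert (i + 1))
  alternate : ∀ i, i + 1 < len →
    (StepM M (vert i) (vert (i + 1)) ↔ ¬ StepM M (vert (i + 1)) (vert (i + 2)))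

namespace AltPath

variable {I : CritInstance A B} {M : Finset (A × B)}

/-- The number of `(+1,+1)` edges of the path. -/
noncomputable def countPP (ρ : AltPath I M) : ℕ :=
  ((Finset.range ρ.len).filter fun i => StepPP I M (ρ.vert i) (ρ.vert (i + 1))).card

/-- The number of `(−1,−1)` edges of the path. -/
noncomputable def countMM (ρ : AltPath I M) : ℕ :=
  ((Finset.range ρ.len).filter fun i => StepMM I M (ρ.vert i) (ρ.vert (i + 1))).card

/-- The vertex `u` lies on the path. -/
def Mem (ρ : AltPath I M) (u : A ⊕ B) : Prop := ∃ i ≤ ρ.len, ρ.vert i = u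

/-- The set of edges of the path, as a set of pairs in `A × B`. -/
noncomputable def edges (ρ : AltPath I M) : Finset (A × B) :=
  I.E.filter fun e => ∃ i < ρ.len,
    (ρ.vert i = Sum.inl e.1 ∧ ρ.vert (i + 1) = Sum.inr e.2) ∨
    (ρ.vert i = Sum.inr e.2 ∧ ρ.vert (i + 1) = Sum.inl e.1)

end AltPath

/-- An `M`-alternating cycle: a closed sequence of vertices `vert 0, …, vert len = vert 0`
(distinct except for the return), consecutive vertices adjacent, with edges alternately
inside and outside `M`, including around the wrap. -/
structure AltCycle (I : CritInstance A B) (M : Finset (A × B)) where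
  len : ℕ
  len_pos : 0 < len
  vert : ℕ → A ⊕ B
  closed : vert len = vert 0
  inj : ∀ i j, i < len → j < len → vert i = vert j → i = j
  adj : ∀ i, i < len → Adj I (vert i) (vert (i + 1))
  alternate : ∀ i, i + 1 < len →
    (StepM M (vert i) (vert (i + 1)) ↔ ¬ StepM M (vert (i + 1)) (vert (i + 2)))
  alternate_wrap : StepM M (vert (len - 1)) (vert len) ↔ ¬ StepM M (vert 0) (vert 1)

namespace AltCycle

variable {I : CritInstance A B} {M : Finset (A × B)}

/-- The number of `(+1,+1)` edges of the cycle. -/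
noncomputable def countPP (σ : AltCycle I M) : ℕ :=
  ((Finset.range σ.len).filter fun i => StepPP I M (σ.vert i) (σ.vert (i + 1))).card

/-- The number of `(−1,−1)` edges of the cycle. -/
noncomputable def countMM (σ : AltCycle I M) : ℕ :=
  ((Finset.range σ.len).filter fun i => StepMM I M (σ.vert i) (σ.vert (i + 1))).card

end AltCycle

/-- A size-increasing alternating path (SIAP) for `M`: an `M`-alternating path whose two
endpoints are a man unmatched in `M` and a woman unmatched in `M`, and which has equally
many `(+1,+1)` and `(−1,−1)` edges. -/
def IsSIAP (I : CritInstance A B) (M : Finset (A × B)) (ρ : AltPath I M) : Prop :=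
  (((∃ m, ρ.vert 0 = Sum.inl m ∧ ¬ ManMatched M m) ∧
      (∃ w, ρ.vert ρ.len = Sum.inr w ∧ ¬ WomanMatched M w)) ∨
    ((∃ w, ρ.vert 0 = Sum.inr w ∧ ¬ WomanMatched M w) ∧
      (∃ m, ρ.vert ρ.len = Sum.inl m ∧ ¬ ManMatched M m))) ∧
  ρ.countPP = ρ.countMM

/-- A size-reducing alternating path (SRAP) for `M` with respect to the level assignment
`(lA, lB)`: an `M`-alternating path both of whose terminal edges lie in `M`, starting at a
woman matched in `M` at level 0, ending at a non-critical man at level 1, whose number of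
`(+1,+1)` edges is exactly one more than its number of `(−1,−1)` edges. -/
def IsSRAP (I : CritInstance A B) (M : Finset (A × B)) (lA : A → ℕ) (lB : B → ℕ)
    (ρ : AltPath I M) : Prop :=
  StepM M (ρ.vert 0) (ρ.vert 1) ∧
  StepM M (ρ.vert (ρ.len - 1)) (ρ.vert ρ.len) ∧
  (((∃ w, ρ.vert 0 = Sum.inr w ∧ WomanMatched M w ∧ lB w = 0) ∧
      (∃ m, ρ.vert ρ.len = Sum.inl m ∧ m ∉ I.C ∧ lA m = 1)) ∨
    ((∃ m, ρ.vert 0 = Sum.inl m ∧ m ∉ I.C ∧ lA m = 1) ∧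
      (∃ w, ρ.vert ρ.len = Sum.inr w ∧ WomanMatched M w ∧ lB w = 0))) ∧
  ρ.countPP = ρ.countMM + 1

end CritInstance

namespace CritInstance

variable {A : Type u} {B : Type v}

lemma Adj.symm {I : CritInstance A B} {x y : A ⊕ B} (h : Adj I x y) : Adj I y x := by
  cases x <;> cases y <;> exact h

lemma stepM_comm (M : Finset (A × B)) (x y : A ⊕ B) : StepM M x y ↔ StepM M y x := by
  cases x <;> cases y <;> exact Iff.rfl

lemma stepPP_comm (I : CritInstance A B) (M : Finset (A × B)) (x y : A ⊕ B) :
    StepPP I M x y ↔ StepPP I M y x := by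
  cases x <;> cases y <;> exact Iff.rfl

lemma stepMM_comm (I : CritInstance A B) (M : Finset (A × B)) (x y : A ⊕ B) :
    StepMM I M x y ↔ StepMM I M y x := by
  cases x <;> cases y <;> exact Iff.rfl

lemma StepPP.not_stepM {I : CritInstance A B} {M : Finset (A × B)} {x y : A ⊕ B}
    (h : StepPP I M x y) : ¬ StepM M x y := by
  cases x <;> cases y <;> first | exact h.2.1 | exact h.elim

lemma StepMM.not_stepM {I : CritInstance A B} {M : Finset (A × B)} {x y : A ⊕ B}
    (h : StepMM I M x y) : ¬ StepM M x y := by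
  cases x <;> cases y <;> first | exact h.2.1 | exact h.elim

/-- A predicate holding only at odd numbers is counted below `2 * k + 1` by its values at
`2 * i + 1` for `i < k`. -/
lemma card_filter_range_two_mul_add_one (P : ℕ → Prop) (k : ℕ)
    (h : ∀ i ≤ k, ¬ P (2 * i)) :
    ((Finset.range (2 * k + 1)).filter P).card =
      ((Finset.range k).filter fun i => P (2 * i + 1)).card := by
  induction k with
  | zero =>
    have := h 0 le_rfl
    simpa [Finset.filter_singleton] using this
  | succ k ih =>
    have h2 : ¬ P (2 * k + 1 + 1) := h (k + 1) le_rfl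
    rw [show 2 * (k + 1) + 1 = 2 * k + 1 + 1 + 1 by ring, Finset.card_filter,
      Finset.sum_range_succ, Finset.sum_range_succ, ← Finset.card_filter,
      ih fun i hi => h i (by omega), if_neg h2, Finset.card_filter, Finset.card_filter,
      Finset.sum_range_succ, add_zero]

lemma card_filter_range_reflect (P Q : ℕ → Prop) (n : ℕ)
    (h : ∀ i < n, P (n - 1 - i) ↔ Q i) :
    ((Finset.range n).filter P).card = ((Finset.range n).filter Q).card := by
  rw [Finset.card_filter, Finset.card_filter, ← Finset.sum_range_reflect]
  refine Finset.sum_congr rfl fun i hi => ?_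
  simp only [h i (Finset.mem_range.1 hi)]

lemma card_filter_and_le_of_card_filter_add_le (P Q : ℕ → Prop) (k : ℕ)
    (h : ((Finset.range k).filter P).card + ((Finset.range k).filter Q).card ≤
      ((Finset.range k).filter fun i => ¬ P i).card + 1 +
        (((Finset.range k).filter fun i => ¬ Q i).card + 1)) :
    ((Finset.range k).filter fun i => P i ∧ Q i).card ≤
      ((Finset.range k).filter fun i => ¬ P i ∧ ¬ Q i).card + 1 := by
  have key : ∀ s : Finset ℕ,
      (s.filter P).card + (s.filter Q).card + 2 * (s.filter fun i => ¬ P i ∧ ¬ Q i).card =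
      (s.filter fun i => ¬ P i).card + (s.filter fun i => ¬ Q i).card +
        2 * (s.filter fun i => P i ∧ Q i).card := by
    intro s
    simp only [Finset.card_filter, Finset.mul_sum, ← Finset.sum_add_distrib]
    refine Finset.sum_congr rfl fun i _ => ?_
    by_cases hp : P i <;> by_cases hq : Q i <;> simp [hp, hq]
  have := key (Finset.range k)
  omega

/-- The matching obtained from `M` by replacing the edges `(f i, g i)`, `i ≤ k`, by the edges
`(f (i + 1), g i)`, `i < k`. -/
noncomputable def shiftMatching (M : Finset (A × B)) (f : ℕ → A) (g : ℕ → B) (k : ℕ) :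
    Finset (A × B) :=
  (M.filter fun e => ∀ i ≤ k, e.1 ≠ f i) ∪
    (Finset.range k).image fun i => (f (i + 1), g i)

lemma mem_shiftMatching {M : Finset (A × B)} {f : ℕ → A} {g : ℕ → B} {k : ℕ} {m : A} {w : B} :
    (m, w) ∈ shiftMatching M f g k ↔
      ((m, w) ∈ M ∧ ∀ i ≤ k, m ≠ f i) ∨ ∃ i < k, f (i + 1) = m ∧ g i = w := by
  simp [shiftMatching]

section Shift

variable {I : CritInstance A B} {M : Finset (A × B)} {f : ℕ → A} {g : ℕ → B} {k : ℕ}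

lemma IsMatching.shiftMatching (hM : IsMatching I M)
    (hf : ∀ i j, i ≤ k → j ≤ k → f i = f j → i = j)
    (hg : ∀ i j, i ≤ k → j ≤ k → g i = g j → i = j)
    (hfg : ∀ i ≤ k, (f i, g i) ∈ M) (hE : ∀ i < k, (f (i + 1), g i) ∈ I.E) :
    IsMatching I (shiftMatching M f g k) := by
  obtain ⟨hME, hA, hB⟩ := hM
  refine ⟨?_, ?_, ?_⟩
  · rintro ⟨m, w⟩ h
    rcases mem_shiftMatching.1 h with h | ⟨i, hi, rfl, rfl⟩
    · exact hME h.1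
    · exact hE i hi
  · intro m w w' h h'
    rcases mem_shiftMatching.1 h with h | ⟨i, hi, rfl, rfl⟩ <;>
      rcases mem_shiftMatching.1 h' with h' | ⟨j, hj, hj1, rfl⟩
    · exact hA h.1 h'.1
    · exact absurd hj1.symm (h.2 _ (by omega))
    · exact absurd rfl (h'.2 (i + 1) (by omega))
    · have := hf _ _ (by omega) (by omega) hj1
      rw [show i = j by omega]
  · intro m m' w h h'
    rcases mem_shiftMatching.1 h with h | ⟨i, hi, rfl, rfl⟩ <;>
      rcases mem_shiftMatching.1 h' with h' | ⟨j, hj, rfl, hj1⟩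
    · exact hB h.1 h'.1
    · subst hj1
      exact absurd (hB h.1 (hfg j hj.le)) (h.2 _ hj.le)
    · exact absurd (hB h'.1 (hfg i hi.le)) (h'.2 _ hi.le)
    · have := hg _ _ (by omega) (by omega) hj1
      rw [this]

lemma IsFeasible.shiftMatching (hM : IsFeasible I M)
    (hf : ∀ i j, i ≤ k → j ≤ k → f i = f j → i = j)
    (hg : ∀ i j, i ≤ k → j ≤ k → g i = g j → i = j)
    (hfg : ∀ i ≤ k, (f i, g i) ∈ M) (hE : ∀ i < k, (f (i + 1), g i) ∈ I.E)
    (h0 : f 0 ∉ I.C) : IsFeasible I (shiftMatching M f g k) := by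
  refine ⟨hM.1.shiftMatching hf hg hfg hE, fun m hm => ?_⟩
  by_cases h : ∃ i ≤ k, m = f i
  · obtain ⟨i, hi, rfl⟩ := h
    cases i with
    | zero => exact absurd hm h0
    | succ i => exact ⟨g i, mem_shiftMatching.2 (.inr ⟨i, by omega, rfl, rfl⟩)⟩
  · push Not at h
    obtain ⟨w, hw⟩ := hM.2 m hm
    exact ⟨w, mem_shiftMatching.2 (.inl ⟨hw, h⟩)⟩

variable [Fintype A] [Fintype B]

lemma le_phi_shiftMatching
    (hf : ∀ i j, i ≤ k → j ≤ k → f i = f j → i = j)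
    (hg : ∀ i j, i ≤ k → j ≤ k → g i = g j → i = j)
    (hfg : ∀ i ≤ k, (f i, g i) ∈ M) :
    ((Finset.range k).filter fun i => I.prefA (f (i + 1)) (g i) (g (i + 1))).card +
      ((Finset.range k).filter fun i => I.prefB (g i) (f (i + 1)) (f i)).card ≤
      phi I (shiftMatching M f g k) M := by
  refine add_le_add ?_ ?_
  · refine Finset.card_le_card_of_injOn (fun i => f (i + 1)) ?_ ?_
    · intro i hi
      simp only [Finset.coe_filter, Finset.mem_range, Set.mem_ofPred_eq] at hi
      simp only [Finset.coe_filter, Finset.mem_univ, true_and, Set.mem_ofPred_eq]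
      exact ⟨g i, mem_shiftMatching.2 (.inr ⟨i, hi.1, rfl, rfl⟩),
        .inr ⟨g (i + 1), hfg _ (by omega), hi.2⟩⟩
    · intro i hi j hj hij
      simp only [Finset.coe_filter, Finset.mem_range, Set.mem_ofPred_eq] at hi hj
      have := hf _ _ (by omega) (by omega) hij
      omega
  · refine Finset.card_le_card_of_injOn g ?_ ?_
    · intro i hi
      simp only [Finset.coe_filter, Finset.mem_range, Set.mem_ofPred_eq] at hi
      simp only [Finset.coe_filter, Finset.mem_univ, true_and, Set.mem_ofPred_eq]
      exact ⟨f (i + 1), mem_shiftMatching.2 (.inr ⟨i, hi.1, rfl, rfl⟩),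
        .inr ⟨f i, hfg _ (by omega), hi.2⟩⟩
    · intro i hi j hj hij
      simp only [Finset.coe_filter, Finset.mem_range, Set.mem_ofPred_eq] at hi hj
      exact hg _ _ (by omega) (by omega) hij

lemma phi_shiftMatching_le (hM : IsMatching I M)
    (hf : ∀ i j, i ≤ k → j ≤ k → f i = f j → i = j)
    (hg : ∀ i j, i ≤ k → j ≤ k → g i = g j → i = j)
    (hfg : ∀ i ≤ k, (f i, g i) ∈ M) (hE : ∀ i < k, (f (i + 1), g i) ∈ I.E) :
    phi I M (shiftMatching M f g k) ≤
      ((Finset.range k).filter fun i => ¬ I.prefA (f (i + 1)) (g i) (g (i + 1))).card + 1 +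
      (((Finset.range k).filter fun i => ¬ I.prefB (g i) (f (i + 1)) (f i)).card + 1) := by
  have hN := hM.shiftMatching hf hg hfg hE
  refine add_le_add ?_ ?_
  · calc
      _ ≤ (insert (f 0) (((Finset.range k).filter fun i =>
            ¬ I.prefA (f (i + 1)) (g i) (g (i + 1))).image fun i => f (i + 1))).card := by
        refine Finset.card_le_card fun m hm => ?_
        obtain ⟨w, hw, hpref⟩ := (Finset.mem_filter.1 hm).2
        by_cases h : ∃ i ≤ k, m = f i
        · obtain ⟨i, hi, rfl⟩ := h
          cases i with
          | zero => exact Finset.mem_insert_self _ _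
          | succ i =>
            have hmem : (f (i + 1), g i) ∈ CritInstance.shiftMatching M f g k :=
              mem_shiftMatching.2 (.inr ⟨i, by omega, rfl, rfl⟩)
            refine Finset.mem_insert_of_mem (Finset.mem_image.2 ⟨i, ?_, rfl⟩)
            refine Finset.mem_filter.2 ⟨Finset.mem_range.2 (by omega), fun hp => ?_⟩
            rcases hpref with hpref | ⟨w', hw', hpref⟩
            · exact hpref ⟨_, hmem⟩
            · obtain rfl := hN.2.1 hw' hmem
              obtain rfl := hM.2.1 hw (hfg _ hi)
              exact I.prefA_irrefl _ _ (I.prefA_trans _ _ _ _ hp hpref)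
        · push Not at h
          have hmem : (m, w) ∈ CritInstance.shiftMatching M f g k :=
            mem_shiftMatching.2 (.inl ⟨hw, h⟩)
          rcases hpref with hpref | ⟨w', hw', hpref⟩
          · exact absurd ⟨_, hmem⟩ hpref
          · obtain rfl := hN.2.1 hw' hmem
            exact absurd hpref (I.prefA_irrefl _ _)
      _ ≤ _ := (Finset.card_insert_le _ _).trans (Nat.succ_le_succ Finset.card_image_le)
  · calc
      _ ≤ (insert (g k) (((Finset.range k).filter fun i =>
            ¬ I.prefB (g i) (f (i + 1)) (f i)).image g)).card := by
        refine Finset.card_le_card fun w hw => ?_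
        obtain ⟨m, hm, hpref⟩ := (Finset.mem_filter.1 hw).2
        by_cases h : ∃ i ≤ k, m = f i
        · obtain ⟨i, hi, rfl⟩ := h
          obtain rfl := hM.2.1 hm (hfg _ hi)
          rcases hi.eq_or_lt with rfl | hik
          · exact Finset.mem_insert_self _ _
          · have hmem : (f (i + 1), g i) ∈ CritInstance.shiftMatching M f g k :=
              mem_shiftMatching.2 (.inr ⟨i, hik, rfl, rfl⟩)
            refine Finset.mem_insert_of_mem (Finset.mem_image.2 ⟨i, ?_, rfl⟩)
            refine Finset.mem_filter.2 ⟨Finset.mem_range.2 hik, fun hp => ?_⟩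
            rcases hpref with hpref | ⟨m', hm', hpref⟩
            · exact hpref ⟨_, hmem⟩
            · obtain rfl := hN.2.2 hm' hmem
              exact I.prefB_irrefl _ _ (I.prefB_trans _ _ _ _ hp hpref)
        · push Not at h
          have hmem : (m, w) ∈ CritInstance.shiftMatching M f g k :=
            mem_shiftMatching.2 (.inl ⟨hm, h⟩)
          rcases hpref with hpref | ⟨m', hm', hpref⟩
          · exact absurd ⟨_, hmem⟩ hpref
          · obtain rfl := hN.2.2 hm' hmem
            exact absurd hpref (I.prefB_irrefl _ _)
      _ ≤ _ := (Finset.card_insert_le _ _).trans (Nat.succ_le_succ Finset.card_image_le)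

/-- The bound on `(+1,+1)` edges for an alternating path `f 0, g 0, f 1, g 1, …, f k, g k`
starting at a non-critical man. -/
lemma IsPFM.card_plusPlus_le (hM : IsPFM I M)
    (hf : ∀ i j, i ≤ k → j ≤ k → f i = f j → i = j)
    (hg : ∀ i j, i ≤ k → j ≤ k → g i = g j → i = j)
    (hfg : ∀ i ≤ k, (f i, g i) ∈ M) (hE : ∀ i < k, (f (i + 1), g i) ∈ I.E)
    (h0 : f 0 ∉ I.C) :
    ((Finset.range k).filter fun i => PlusPlus I M (f (i + 1)) (g i)).card ≤
      ((Finset.range k).filter fun i => MinusMinus I M (f (i + 1)) (g i)).card + 1 := by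
  obtain ⟨⟨hmat, hfeas⟩, hpop⟩ := hM
  have key := card_filter_and_le_of_card_filter_add_le
    (fun i => I.prefA (f (i + 1)) (g i) (g (i + 1))) (fun i => I.prefB (g i) (f (i + 1)) (f i)) k
    ((le_phi_shiftMatching hf hg hfg).trans
      ((hpop _ (IsFeasible.shiftMatching ⟨hmat, hfeas⟩ hf hg hfg hE h0)).trans
        (phi_shiftMatching_le hmat hf hg hfg hE)))
  refine le_trans (Finset.card_le_card ?_)
    (key.trans (Nat.succ_le_succ (Finset.card_le_card ?_)))
  · intro i hi
    obtain ⟨hi, -, -, hm, hw⟩ := Finset.mem_filter.1 hi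
    have hik := Finset.mem_range.1 hi
    refine Finset.mem_filter.2 ⟨hi, ?_, ?_⟩
    · rcases hm with hm | ⟨w', hw', hp⟩
      · exact absurd ⟨_, hfg (i + 1) hik⟩ hm
      · rwa [hmat.2.1 hw' (hfg (i + 1) hik)] at hp
    · rcases hw with hw | ⟨m', hm', hp⟩
      · exact absurd ⟨_, hfg i hik.le⟩ hw
      · rwa [hmat.2.2 hm' (hfg i hik.le)] at hp
  · intro i hi
    obtain ⟨hi, hp, hq⟩ := Finset.mem_filter.1 hi
    have hik := Finset.mem_range.1 hi
    have hgne : g i ≠ g (i + 1) := fun h => by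
      have := hg _ _ hik.le hik h
      omega
    have hfne : f (i + 1) ≠ f i := fun h => by
      have := hf _ _ hik hik.le h
      omega
    refine Finset.mem_filter.2 ⟨hi, hE i hik, fun h => hgne (hmat.2.1 h (hfg _ hik)),
      ⟨_, hfg _ hik, ?_⟩, ⟨_, hfg _ hik.le, ?_⟩⟩
    · exact (I.prefA_total _ _ _ (hE i hik) (hmat.1 (hfg _ hik)) hgne).resolve_left hp
    · exact (I.prefB_total _ _ _ (hE i hik) (hmat.1 (hfg _ hik.le)) hfne).resolve_left hq

end Shift

namespace AltPath

variable {I : CritInstance A B} {M : Finset (A × B)}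

lemma stepM_iff_even (ρ : AltPath I M) (h0 : StepM M (ρ.vert 0) (ρ.vert 1)) (i : ℕ)
    (hi : i < ρ.len) : StepM M (ρ.vert i) (ρ.vert (i + 1)) ↔ Even i := by
  induction i with
  | zero => simpa using h0
  | succ i ih =>
    rw [Nat.even_add_one, ← ih (by omega), ρ.alternate i hi, not_not]

lemma vert_parity (ρ : AltPath I M) {m : A} (hm : ρ.vert 0 = Sum.inl m) (i : ℕ)
    (hi : i ≤ ρ.len) : (ρ.vert i).isLeft ↔ Even i := by
  induction i with
  | zero => simp [hm]
  | succ i ih =>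
    rw [Nat.even_add_one, ← ih (by omega)]
    have := ρ.adj i hi
    revert this
    cases ρ.vert i <;> cases ρ.vert (i + 1) <;> simp [Adj]

/-- The path traversed backwards. -/
def reverse (ρ : AltPath I M) : AltPath I M where
  len := ρ.len
  len_pos := ρ.len_pos
  vert i := ρ.vert (ρ.len - i)
  inj i j hi hj h := by
    have := ρ.inj _ _ (Nat.sub_le _ _) (Nat.sub_le _ _) h
    omega
  adj i hi := by
    have := ρ.adj (ρ.len - (i + 1)) (by omega)
    rw [show ρ.len - (i + 1) + 1 = ρ.len - i by omega] at this
    exact this.symm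
  alternate i hi := by
    have := ρ.alternate (ρ.len - (i + 2)) (by omega)
    rw [show ρ.len - (i + 2) + 1 = ρ.len - (i + 1) by omega,
      show ρ.len - (i + 2) + 2 = ρ.len - i by omega] at this
    rw [stepM_comm M (ρ.vert (ρ.len - i)),
      stepM_comm M (ρ.vert (ρ.len - (i + 1))) (ρ.vert (ρ.len - (i + 2))), this, not_not]

lemma countPP_reverse (ρ : AltPath I M) : ρ.reverse.countPP = ρ.countPP := by
  refine card_filter_range_reflect _ _ _ fun i hi => ?_
  change i < ρ.len at hi
  change StepPP I M (ρ.vert (ρ.len - (ρ.len - 1 - i)))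
    (ρ.vert (ρ.len - (ρ.len - 1 - i + 1))) ↔ _
  rw [show ρ.len - (ρ.len - 1 - i) = i + 1 by omega,
    show ρ.len - (ρ.len - 1 - i + 1) = i by omega, stepPP_comm]

lemma countMM_reverse (ρ : AltPath I M) : ρ.reverse.countMM = ρ.countMM := by
  refine card_filter_range_reflect _ _ _ fun i hi => ?_
  change i < ρ.len at hi
  change StepMM I M (ρ.vert (ρ.len - (ρ.len - 1 - i)))
    (ρ.vert (ρ.len - (ρ.len - 1 - i + 1))) ↔ _
  rw [show ρ.len - (ρ.len - 1 - i) = i + 1 by omega,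
    show ρ.len - (ρ.len - 1 - i + 1) = i by omega, stepMM_comm]

lemma countPP_le_of_vert_zero [Fintype A] [Fintype B] (hM : I.IsPFM M) (ρ : AltPath I M)
    (h0 : StepM M (ρ.vert 0) (ρ.vert 1))
    (h1 : StepM M (ρ.vert (ρ.len - 1)) (ρ.vert ρ.len))
    {m : A} (hm : ρ.vert 0 = Sum.inl m) (hC : m ∉ I.C) :
    ρ.countPP ≤ ρ.countMM + 1 := by
  have hpos := ρ.len_pos
  have hstep := ρ.stepM_iff_even h0
  obtain ⟨k, hk⟩ : ∃ k, ρ.len = 2 * k + 1 := by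
    have := hstep (ρ.len - 1) (by omega)
    rw [Nat.sub_add_cancel hpos] at this
    obtain ⟨k, hk⟩ := this.1 h1
    exact ⟨k, by omega⟩
  have hleft : ∀ i, ∃ a, i ≤ k → ρ.vert (2 * i) = Sum.inl a := by
    intro i
    by_cases hi : i ≤ k
    · obtain ⟨a, ha⟩ := Sum.isLeft_iff.1
        ((ρ.vert_parity hm (2 * i) (by omega)).2 (even_two_mul i))
      exact ⟨a, fun _ => ha⟩
    · exact ⟨m, fun h => absurd h hi⟩
  have hright : ∀ i ≤ k, ∃ b, ρ.vert (2 * i + 1) = Sum.inr b := by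
    intro i hi
    refine Sum.isRight_iff.1 (Sum.not_isLeft.1 fun h => ?_)
    exact absurd ((ρ.vert_parity hm (2 * i + 1) (by omega)).1 h) (by simp)
  obtain ⟨b₀, -⟩ := hright 0 (Nat.zero_le _)
  have hright' : ∀ i, ∃ b, i ≤ k → ρ.vert (2 * i + 1) = Sum.inr b := by
    intro i
    by_cases hi : i ≤ k
    · obtain ⟨b, hb⟩ := hright i hi
      exact ⟨b, fun _ => hb⟩
    · exact ⟨b₀, fun h => absurd h hi⟩
  choose f hf using hleft
  choose g hg using hright'
  have hodd : ∀ i < k, ρ.vert (2 * i + 1 + 1) = Sum.inl (f (i + 1)) := fun i hi => hf (i + 1) hi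
  have hPP : ρ.countPP =
      ((Finset.range k).filter fun i => PlusPlus I M (f (i + 1)) (g i)).card := by
    rw [countPP, hk, card_filter_range_two_mul_add_one]
    · refine congrArg Finset.card (Finset.filter_congr fun i hi => ?_)
      have hik := Finset.mem_range.1 hi
      rw [hg i hik.le, hodd i hik]
      exact Iff.rfl
    · exact fun i hi h => h.not_stepM ((hstep _ (by omega)).2 (even_two_mul i))
  have hMM : ρ.countMM =
      ((Finset.range k).filter fun i => MinusMinus I M (f (i + 1)) (g i)).card := by
    rw [countMM, hk, card_filter_range_two_mul_add_one]
    · refine congrArg Finset.card (Finset.filter_congr fun i hi => ?_)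
      have hik := Finset.mem_range.1 hi
      rw [hg i hik.le, hodd i hik]
      exact Iff.rfl
    · exact fun i hi h => h.not_stepM ((hstep _ (by omega)).2 (even_two_mul i))
  rw [hPP, hMM]
  refine hM.card_plusPlus_le ?_ ?_ ?_ ?_ ?_
  · intro i j hi hj hij
    have := ρ.inj (2 * i) (2 * j) (by omega) (by omega) (by rw [hf i hi, hf j hj, hij])
    omega
  · intro i j hi hj hij
    have := ρ.inj (2 * i + 1) (2 * j + 1) (by omega) (by omega) (by rw [hg i hi, hg j hj, hij])
    omega
  · intro i hi
    have := (hstep (2 * i) (by omega)).2 (even_two_mul i)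
    rwa [hf i hi, hg i hi] at this
  · intro i hi
    have := ρ.adj (2 * i + 1) (by omega)
    rwa [hg i hi.le, hodd i hi] at this
  · have := hf 0 (Nat.zero_le _)
    rw [mul_zero, hm] at this
    rwa [← Sum.inl.inj this]

end AltPath

end CritInstance

/-- If `M` is a popular feasible matching, then every `M`-alternating
path both of whose terminal edges lie in `M` and whose endpoint in `A` is a non-critical
man has at most one more `(+1,+1)` edge than `(−1,−1)` edges. -/
theorem altPath_matched_ends_countPP_le {A : Type u} {B : Type v} [Fintype A] [Fintype B]
    (I : CritInstance A B) (M : Finset (A × B)) (hM : I.IsPFM M)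
    (ρ : CritInstance.AltPath I M)
    (h0 : CritInstance.StepM M (ρ.vert 0) (ρ.vert 1))
    (h1 : CritInstance.StepM M (ρ.vert (ρ.len - 1)) (ρ.vert ρ.len))
    (hend : ∃ m, (ρ.vert 0 = Sum.inl m ∨ ρ.vert ρ.len = Sum.inl m) ∧ m ∉ I.C) :
    ρ.countPP ≤ ρ.countMM + 1 := by
  obtain ⟨m, hm | hm, hC⟩ := hend
  · exact ρ.countPP_le_of_vert_zero hM h0 h1 hm hC
  · have hpos := ρ.len_pos
    rw [← ρ.countPP_reverse, ← ρ.countMM_reverse]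
    refine ρ.reverse.countPP_le_of_vert_zero hM ?_ ?_ hm hC
    · exact (CritInstance.stepM_comm _ _ _).1 h1
    · change CritInstance.StepM M (ρ.vert (ρ.len - (ρ.len - 1))) (ρ.vert (ρ.len - ρ.len))
      rw [Nat.sub_self, show ρ.len - (ρ.len - 1) = 1 by omega]
      exact (CritInstance.stepM_comm _ _ _).1 h0
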